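/- Let A ∈ ℝ^{n×n} and let P ∈ ℝ^{n×n} be a permutation matrix. Assume that ‖x_A⁽ᵗ⁾‖₁ ≠ 0 for all 0 ≤ t < k. Then the Gaussian functional representations agree pointwise: for every x ∈ ℝᵏ, Ψ^{PAPᵀ}(x) = Ψ^A(x). -/

import Mathlib

open Matrix MeasureTheory Real BigOperators

/-- The permutation matrix of `σ`: `(P v) (σ i) = v i`. -/
noncomputable def permMatrix {n : ℕ} (σ : Equiv.Perm (Fin n)) : Matrix (Fin n) (Fin n) ℝ :=
  Matrix.of fun i j => if i = σ j then 1 else 0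

/-- ℓ1 norm of a vector. -/
noncomputable def l1norm {n : ℕ} (v : Fin n → ℝ) : ℝ := ∑ i, |v i|

/-- Power iteration started at the all-ones vector. -/
noncomputable def powerIter {n : ℕ} (A : Matrix (Fin n) (Fin n) ℝ) : ℕ → (Fin n → ℝ)
  | 0 => fun _ => 1
  | t + 1 => A.mulVec ((l1norm (powerIter A t))⁻¹ • powerIter A t)

/-- Power summary `S^A ∈ ℝ^{n×k}`, whose `t`-th column is `x_A^{(t+1)}`. -/
noncomputable def powSummary {n : ℕ} (k : ℕ) (A : Matrix (Fin n) (Fin n) ℝ) :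
    Matrix (Fin n) (Fin k) ℝ :=
  Matrix.of fun i t => powerIter A (t + 1) i

/-- Mean vector of the rows of the power summary. -/
noncomputable def meanVec {n : ℕ} (k : ℕ) (A : Matrix (Fin n) (Fin n) ℝ) : Fin k → ℝ :=
  (n : ℝ)⁻¹ • ∑ i, powSummary k A i

/-- Sample covariance matrix of the rows of the power summary. -/
noncomputable def covMat {n : ℕ} (k : ℕ) (A : Matrix (Fin n) (Fin n) ℝ) :
    Matrix (Fin k) (Fin k) ℝ :=
  (n : ℝ)⁻¹ • ∑ i, vecMulVec (powSummary k A i - meanVec k A) (powSummary k A i - meanVec k A)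

/-- Gaussian functional representation `Ψ^A`. -/
noncomputable def psi {n : ℕ} (k : ℕ) (A : Matrix (Fin n) (Fin n) ℝ) (x : Fin k → ℝ) : ℝ :=
  (Real.sqrt ((2 * Real.pi) ^ k * (covMat k A).det))⁻¹ *
    Real.exp (-(dotProduct (x - meanVec k A) ((covMat k A)⁻¹ *ᵥ (x - meanVec k A))) / 2)


/-- Conjugating by a permutation matrix relabels rows and columns. -/
theorem permMatrix_conj_eq_submatrix {n : ℕ} (A : Matrix (Fin n) (Fin n) ℝ)
    (σ : Equiv.Perm (Fin n)) :
    permMatrix σ * A * (permMatrix σ)ᵀ = A.submatrix σ.symm σ.symm := by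
  ext i j
  simp [permMatrix, Matrix.mul_apply, ← Equiv.symm_apply_eq]

theorem l1norm_comp_perm {n : ℕ} (v : Fin n → ℝ) (σ : Equiv.Perm (Fin n)) :
    l1norm (v ∘ σ) = l1norm v :=
  Equiv.sum_comp σ fun i => |v i|

/-- Power iteration is equivariant under relabelling. -/
theorem powerIter_submatrix {n : ℕ} (A : Matrix (Fin n) (Fin n) ℝ)
    (σ : Equiv.Perm (Fin n)) (t : ℕ) :
    powerIter (A.submatrix σ σ) t = powerIter A t ∘ σ := by
  induction t with
  | zero => rfl
  | succ t ih =>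
    rw [powerIter, powerIter, ih, l1norm_comp_perm, Matrix.submatrix_mulVec_equiv]
    congr 2
    ext i
    simp

theorem powSummary_submatrix {n : ℕ} (A : Matrix (Fin n) (Fin n) ℝ)
    (σ : Equiv.Perm (Fin n)) (k : ℕ) (i : Fin n) :
    powSummary k (A.submatrix σ σ) i = powSummary k A (σ i) := by
  ext t
  simp [powSummary, powerIter_submatrix]

theorem meanVec_submatrix {n : ℕ} (A : Matrix (Fin n) (Fin n) ℝ)
    (σ : Equiv.Perm (Fin n)) (k : ℕ) :
    meanVec k (A.submatrix σ σ) = meanVec k A := by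
  simp only [meanVec, powSummary_submatrix]
  rw [Equiv.sum_comp σ (powSummary k A)]

theorem covMat_submatrix {n : ℕ} (A : Matrix (Fin n) (Fin n) ℝ)
    (σ : Equiv.Perm (Fin n)) (k : ℕ) :
    covMat k (A.submatrix σ σ) = covMat k A := by
  simp only [covMat, powSummary_submatrix, meanVec_submatrix]
  rw [Equiv.sum_comp σ fun i =>
    vecMulVec (powSummary k A i - meanVec k A) (powSummary k A i - meanVec k A)]

/-- Theorem 2: the Gaussian functional representation `Ψ^A` is a graph invariant. -/
theorem psi_perm_invariant {n k : ℕ} (A : Matrix (Fin n) (Fin n) ℝ)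
    (σ : Equiv.Perm (Fin n))
    (hl1 : ∀ t < k, l1norm (powerIter A t) ≠ 0) :
    ∀ x : Fin k → ℝ, psi k (permMatrix σ * A * (permMatrix σ)ᵀ) x = psi k A x := by
  intro x
  simp only [psi, permMatrix_conj_eq_submatrix, meanVec_submatrix, covMat_submatrix]
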